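/- Given δ > 0 and m, r ∈ ℕ, there exist ε > 0 and n_0 = n_0(ε,δ,m,r) ∈ ℕ such that the following holds. Let G be a graph on vertex set A_1 ∪ … ∪ A_r, where |A_j| ≥ n_0 for each j ∈ [r], and suppose that each pair (A_i,A_j) with i ≠ j is (ε,δ)-grey. Then there exists v ∈ {0,1}^r such that every graph H ∈ ℋ(r,v) with at most m vertices is an induced subgraph of G. -/

import Mathlib

open scoped symmDiff

namespace ABBM

variable {V : Type*}

/-- `A` shatters `B` in `G`: every subset of `B` is the neighbourhood (within `B`)
of some vertex of `A`.  This is the paper's relation `A → B`. -/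
def Shatters (G : SimpleGraph V) (A B : Finset V) : Prop :=
  ∀ S ⊆ B, ∃ a ∈ A, ∀ b ∈ B, G.Adj a b ↔ b ∈ S

/-- `G` is `U(k)`-free: there are no disjoint vertex sets `X`, `Y` such that the
bipartite graph induced by `G` between `X` and `Y` is (a copy of) `U(k)`;
equivalently, no disjoint `X`, `Y` with `|Y| = k` and `X` shattering `Y`. -/
def UFree (G : SimpleGraph V) (k : ℕ) : Prop :=
  ¬ ∃ X Y : Finset V, Disjoint X Y ∧ Y.card = k ∧ Shatters G X Y

/-- The induced subgraph of `G` on `S` is `U(k)`-free. -/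
def UFreeOn (G : SimpleGraph V) (S : Finset V) (k : ℕ) : Prop :=
  ¬ ∃ X Y : Finset V, X ⊆ S ∧ Y ⊆ S ∧ Disjoint X Y ∧ Y.card = k ∧ Shatters G X Y

open scoped Classical in
/-- The (full) neighbourhood `Γ(u)` of a vertex, as a `Finset`. -/
noncomputable def nbr [Fintype V] (G : SimpleGraph V) (u : V) : Finset V :=
  Finset.univ.filter fun v => G.Adj u v

/-- A hereditary property of labelled graphs: a collection of graphs on `[n]` for each `n`,
closed under relabelling (isomorphism) and under taking induced subgraphs; both closures are
expressed by closure under pulling back along arbitrary injections. -/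
def IsHereditary (P : ∀ n, Set (SimpleGraph (Fin n))) : Prop :=
  ∀ {m n : ℕ} (f : Fin m ↪ Fin n) (G : SimpleGraph (Fin n)),
    G ∈ P n → SimpleGraph.comap (f : Fin m → Fin n) G ∈ P m

/-- `G` belongs to the class `ℋ(r,v)`: its vertex set can be partitioned into `r` parts
so that part `j` induces a complete graph if `v j = true` and an empty graph otherwise. -/
def InHClass {n : ℕ} (r : ℕ) (v : Fin r → Bool) (G : SimpleGraph (Fin n)) : Prop :=
  ∃ f : Fin n → Fin r, ∀ x y : Fin n, x ≠ y → f x = f y → (G.Adj x y ↔ v (f x) = true)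

/-- `ℋ(r,v) ⊆ 𝒫` for some `v ∈ {0,1}^r`. -/
def HContained (P : ∀ n, Set (SimpleGraph (Fin n))) (r : ℕ) : Prop :=
  ∃ v : Fin r → Bool, ∀ (n : ℕ) (G : SimpleGraph (Fin n)), InHClass r v G → G ∈ P n

/-- The colouring number of `𝒫` equals `r`: `r` is maximal with `ℋ(r,v) ⊆ 𝒫` for some `v`. -/
def ColNumEq (P : ∀ n, Set (SimpleGraph (Fin n))) (r : ℕ) : Prop :=
  HContained P r ∧ ∀ s : ℕ, HContained P s → s ≤ r

/-- The edge density `d(A,B)` of the bipartite graph induced by `G` between `A` and `B`. -/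
noncomputable def density (G : SimpleGraph V) (A B : Finset V) : ℝ :=
  {p : V × V | p.1 ∈ A ∧ p.2 ∈ B ∧ G.Adj p.1 p.2}.ncard / ((A.card : ℝ) * (B.card : ℝ))

/-- The pair `(A,B)` is `ε`-regular in `G`. -/
def IsRegularPair (G : SimpleGraph V) (ε : ℝ) (A B : Finset V) : Prop :=
  ∀ X ⊆ A, ∀ Y ⊆ B, ε * (A.card : ℝ) ≤ (X.card : ℝ) → ε * (B.card : ℝ) ≤ (Y.card : ℝ) →
    |density G A B - density G X Y| < ε

/-- The pair `(A,B)` is `(ε,δ)`-grey: `ε`-regular with density in `[δ, 1-δ]`. -/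
def IsGrey (G : SimpleGraph V) (ε δ : ℝ) (A B : Finset V) : Prop :=
  IsRegularPair G ε A B ∧ δ ≤ density G A B ∧ density G A B ≤ 1 - δ

/-- `Q` is a Szemerédi partition of `G` for `ε` (into `m` parts): an equitable partition
of the vertex set all but `ε m²` of whose pairs are `ε`-regular. -/
def IsSzemeredi [Fintype V] [DecidableEq V] (G : SimpleGraph V) (ε : ℝ) {m : ℕ}
    (Q : Fin m → Finset V) : Prop :=
  (∀ i j : Fin m, i ≠ j → Disjoint (Q i) (Q j)) ∧
  Finset.univ.biUnion Q = Finset.univ ∧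
  (∀ i j : Fin m, (Q i).card ≤ (Q j).card + 1) ∧
  ({p : Fin m × Fin m | p.1 < p.2 ∧ ¬ IsRegularPair G ε (Q p.1) (Q p.2)}.ncard : ℝ)
    ≤ ε * (m : ℝ) ^ 2

/-- `(S 1, …, S r)` is a BBS-partition of `G` for `(ε,δ,γ)`:  there is a Szemerédi
partition of `G` for `ε` into `m > 1/ε` parts such that each `S j` is the union of an
almost equal number of the Szemerédi sets, and each `S j` contains at most `γ m²`
`(ε,δ)`-grey pairs of Szemerédi sets. -/
def IsBBS [Fintype V] [DecidableEq V] (G : SimpleGraph V) (ε δ γ : ℝ) {r : ℕ}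
    (S : Fin r → Finset V) : Prop :=
  ∃ m : ℕ, 1 / ε < (m : ℝ) ∧ ∃ Q : Fin m → Finset V, IsSzemeredi G ε Q ∧
    ∃ g : Fin m → Fin r,
      (∀ j : Fin r, S j = (Finset.univ.filter fun i => g i = j).biUnion Q) ∧
      (∀ j j' : Fin r, (Finset.univ.filter fun i => g i = j).card ≤
          (Finset.univ.filter fun i => g i = j').card + 1) ∧
      (∀ j : Fin r, ({p : Fin m × Fin m | p.1 < p.2 ∧ g p.1 = j ∧ g p.2 = j ∧
          IsGrey G ε δ (Q p.1) (Q p.2)}.ncard : ℝ) ≤ γ * (m : ℝ) ^ 2)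

open scoped Classical in
/-- The `k`-tuples of vertices of `A` whose entries are pairwise adjacent in `G`. -/
noncomputable def cliqueTuples (G : SimpleGraph V) (A : Finset V) (k : ℕ) :
    Finset (Fin k → V) :=
  (Fintype.piFinset fun _ => A).filter fun x => ∀ i j, i ≠ j → G.Adj (x i) (x j)

lemma mem_cliqueTuples {G : SimpleGraph V} {A : Finset V} {k : ℕ} {x : Fin k → V} :
    x ∈ cliqueTuples G A k ↔ (∀ i, x i ∈ A) ∧ ∀ i j, i ≠ j → G.Adj (x i) (x j) := by
  simp [cliqueTuples]

lemma card_cliqueTuples_zero (G : SimpleGraph V) (A : Finset V) :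
    (cliqueTuples G A 0).card = 1 := by
  rw [Finset.card_eq_one]
  refine ⟨Fin.elim0, Finset.ext fun x => ?_⟩
  simp [mem_cliqueTuples, Subsingleton.elim x Fin.elim0]

lemma cliqueTuples_mono (G : SimpleGraph V) {A B : Finset V} (h : A ⊆ B) (k : ℕ) :
    cliqueTuples G A k ⊆ cliqueTuples G B k := fun x hx => by
  rw [mem_cliqueTuples] at hx ⊢
  exact ⟨fun i => h (hx.1 i), hx.2⟩

open scoped Classical in
lemma sum_card_cliqueTuples_le (G : SimpleGraph V) (A : Finset V) (k : ℕ) :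
    ∑ x ∈ A, (cliqueTuples G (A.filter (G.Adj x)) k).card ≤ (cliqueTuples G A (k + 1)).card := by
  rw [← Finset.card_sigma]
  refine Finset.card_le_card_of_injOn (fun p => Fin.cons p.1 p.2) ?_ ?_
  · rintro ⟨x, y⟩ h
    simp only [Finset.coe_sigma, Set.mem_sigma_iff, Finset.mem_coe, mem_cliqueTuples,
      Finset.mem_filter] at h ⊢
    obtain ⟨hx, hy, hadj⟩ := h
    refine ⟨fun i => ?_, fun i j hij => ?_⟩
    · cases i using Fin.cases with
      | zero => simpa using hx
      | succ i => simpa using (hy i).1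
    · cases i using Fin.cases with
      | zero =>
        cases j using Fin.cases with
        | zero => exact absurd rfl hij
        | succ j => simpa using (hy j).2
      | succ i =>
        cases j using Fin.cases with
        | zero => simpa using (hy i).2.symm
        | succ j => simpa using hadj i j (by rintro rfl; exact hij rfl)
  · rintro ⟨x, y⟩ - ⟨x', y'⟩ - h
    obtain ⟨h₁, h₂⟩ := Fin.cons_inj.1 h
    subst h₁ h₂
    rfl

open scoped Classical in
/-- The induction step of the supersaturated Ramsey theorem, when at least half of the vertices
have large degree in `G`. -/
lemma card_cliqueTuples_step {G G' : SimpleGraph V} {A : Finset V} {a b n : ℕ} {c : ℝ}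
    (hc : 0 ≤ c)
    (ih : ∀ B : Finset V, n ≤ B.card → c * (B.card : ℝ) ^ a ≤ (cliqueTuples G B a).card ∨
      c * (B.card : ℝ) ^ b ≤ (cliqueTuples G' B b).card)
    (hn : 4 * n ≤ A.card)
    (hB : A.card ≤ 2 * (A.filter fun x => A.card ≤ 4 * (A.filter (G.Adj x)).card).card) :
    c / 4 ^ (a + 1) * (A.card : ℝ) ^ (a + 1) ≤ (cliqueTuples G A (a + 1)).card ∨
      c / 4 ^ b * (A.card : ℝ) ^ b ≤ (cliqueTuples G' A b).card := by
  set B := A.filter fun x => A.card ≤ 4 * (A.filter (G.Adj x)).card with hBdef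
  have key : ∀ x ∈ B, ∀ k : ℕ, c / 4 ^ k * (A.card : ℝ) ^ k ≤
      c * ((A.filter (G.Adj x)).card : ℝ) ^ k := fun x hx k => by
    have h : (A.card : ℝ) / 4 ≤ (A.filter (G.Adj x)).card := by
      have : (A.card : ℝ) ≤ 4 * (A.filter (G.Adj x)).card := by
        exact_mod_cast (Finset.mem_filter.1 hx).2
      linarith
    calc c / 4 ^ k * (A.card : ℝ) ^ k = c * ((A.card : ℝ) / 4) ^ k := by
          rw [div_pow]; ring
      _ ≤ _ := by gcongr
  by_cases h : ∃ x ∈ B, c * ((A.filter (G.Adj x)).card : ℝ) ^ b ≤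
      (cliqueTuples G' (A.filter (G.Adj x)) b).card
  · obtain ⟨x, hx, h⟩ := h
    refine Or.inr ((key x hx b).trans (h.trans ?_))
    exact_mod_cast Finset.card_le_card (cliqueTuples_mono G' (Finset.filter_subset _ _) b)
  · push Not at h
    left
    have hB' : (A.card : ℝ) ≤ 2 * B.card := by exact_mod_cast hB
    have hle : (B.card : ℝ) * (c / 4 ^ a * (A.card : ℝ) ^ a) ≤
        (cliqueTuples G A (a + 1)).card := by
      calc (B.card : ℝ) * (c / 4 ^ a * (A.card : ℝ) ^ a)
          = ∑ x ∈ B, c / 4 ^ a * (A.card : ℝ) ^ a := by simp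
        _ ≤ ∑ x ∈ B, ((cliqueTuples G (A.filter (G.Adj x)) a).card : ℝ) := by
          refine Finset.sum_le_sum fun x hx => (key x hx a).trans ?_
          refine (ih _ ?_).resolve_right (h x hx).not_ge
          have := (Finset.mem_filter.1 hx).2
          omega
        _ ≤ ∑ x ∈ A, ((cliqueTuples G (A.filter (G.Adj x)) a).card : ℝ) :=
          Finset.sum_le_sum_of_subset_of_nonneg (Finset.filter_subset _ _)
            fun _ _ _ => Nat.cast_nonneg _
        _ ≤ _ := by exact_mod_cast sum_card_cliqueTuples_le G A a
    refine le_trans ?_ hle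
    have : c / 4 ^ (a + 1) * (A.card : ℝ) ^ (a + 1) =
        (A.card : ℝ) / 4 * (c / 4 ^ a * (A.card : ℝ) ^ a) := by
      rw [pow_succ, pow_succ]; field_simp
    rw [this]
    gcongr
    have : (0 : ℝ) ≤ A.card := Nat.cast_nonneg _
    linarith

/-- Supersaturated Ramsey theorem: a positive proportion of the `a`-tuples are red cliques, or a
positive proportion of the `b`-tuples are blue cliques. -/
theorem exists_le_card_cliqueTuples (a b : ℕ) :
    ∃ c : ℝ, 0 < c ∧ ∃ n : ℕ, ∀ (V : Type) (G G' : SimpleGraph V) (A : Finset V),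
      (∀ x y, x ≠ y → G.Adj x y ∨ G'.Adj x y) → n ≤ A.card →
      c * (A.card : ℝ) ^ a ≤ (cliqueTuples G A a).card ∨
        c * (A.card : ℝ) ^ b ≤ (cliqueTuples G' A b).card := by
  classical
  induction a generalizing b with
  | zero => exact ⟨1, one_pos, 0, fun V G G' A _ _ => Or.inl (by simp [card_cliqueTuples_zero])⟩
  | succ a iha =>
    induction b with
    | zero => exact ⟨1, one_pos, 0, fun V G G' A _ _ => Or.inr (by simp [card_cliqueTuples_zero])⟩
    | succ b ihb =>
      obtain ⟨c₁, hc₁, n₁, h₁⟩ := iha (b + 1)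
      obtain ⟨c₂, hc₂, n₂, h₂⟩ := ihb
      refine ⟨min c₁ c₂ / 4 ^ (a + b + 2), by positivity, 4 * (n₁ + n₂) + 2,
        fun V G G' A hG hA => ?_⟩
      have weaken : ∀ c k, 0 < c → min c₁ c₂ ≤ c → k ≤ a + b + 2 → ∀ t : ℝ,
          c / 4 ^ k * (A.card : ℝ) ^ k ≤ t →
          min c₁ c₂ / 4 ^ (a + b + 2) * (A.card : ℝ) ^ k ≤ t := fun c k hc hle hk t ht => by
        refine le_trans ?_ ht
        gcongr
        norm_num
      set B := A.filter fun x => A.card ≤ 4 * (A.filter (G.Adj x)).card with hB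
      set B' := A.filter fun x => A.card ≤ 4 * (A.filter (G'.Adj x)).card with hB'
      have hcover : A ⊆ B ∪ B' := fun x hx => by
        have hsub : A ⊆ insert x (A.filter (G.Adj x) ∪ A.filter (G'.Adj x)) := fun y hy => by
          by_cases hxy : x = y
          · simp [hxy]
          · have := hG x y hxy
            simp only [Finset.mem_insert, Finset.mem_union, Finset.mem_filter]
            tauto
        have h := (Finset.card_le_card hsub).trans (Finset.card_insert_le _ _)
        have h' := Finset.card_union_le (A.filter (G.Adj x)) (A.filter (G'.Adj x))
        simp only [hB, hB', Finset.mem_union, Finset.mem_filter, hx, true_and]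
        omega
      have hcard := (Finset.card_le_card hcover).trans (Finset.card_union_le _ _)
      by_cases hlarge : A.card ≤ 2 * B.card
      · refine (card_cliqueTuples_step hc₁.le (fun C hC => h₁ V G G' C hG hC)
          (by omega) hlarge).imp ?_ ?_
        · exact weaken c₁ _ hc₁ (min_le_left _ _) (by omega) _
        · exact weaken c₁ _ hc₁ (min_le_left _ _) (by omega) _
      · refine ((card_cliqueTuples_step hc₂.le (fun C hC => (h₂ V G G' C hG hC).symm)
          (by omega) (show A.card ≤ 2 * B'.card by omega)).imp ?_ ?_).symm
        · exact weaken c₂ _ hc₂ (min_le_right _ _) (by omega) _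
        · exact weaken c₂ _ hc₂ (min_le_right _ _) (by omega) _

open scoped Classical in
/-- In a grey pair, edges and non-edges both occur with positive density between any two
large subsets. -/
lemma IsGrey.le_card_filter {G : SimpleGraph V} {ε δ β : ℝ} {A B : Finset V}
    (h : IsGrey G ε δ A B) (hε : 0 < ε) (hβ₀ : 0 ≤ β) (hβ₁ : β ≤ 1) (hβ : β + ε ≤ δ)
    (hA : A.Nonempty) (hB : B.Nonempty) {U W : Finset V} (hU : U ⊆ A) (hW : W ⊆ B) (P : Prop) :
    β * ((U.card : ℝ) * W.card) - ε * ((A.card : ℝ) * B.card) ≤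
      ((U ×ˢ W).filter fun p => G.Adj p.1 p.2 ↔ P).card := by
  have hUA : (U.card : ℝ) ≤ A.card := by exact_mod_cast Finset.card_le_card hU
  have hWB : (W.card : ℝ) ≤ B.card := by exact_mod_cast Finset.card_le_card hW
  have hu : (0 : ℝ) ≤ U.card := Nat.cast_nonneg _
  have hw : (0 : ℝ) ≤ W.card := Nat.cast_nonneg _
  have ha : (0 : ℝ) < A.card := by exact_mod_cast hA.card_pos
  have hb : (0 : ℝ) < B.card := by exact_mod_cast hB.card_pos
  by_cases hlarge : ε * (A.card : ℝ) ≤ U.card ∧ ε * (B.card : ℝ) ≤ W.card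
  · have hreg := abs_lt.1 (h.1 U hU W hW hlarge.1 hlarge.2)
    have hd := h.2
    have hpos : (0 : ℝ) < (U.card : ℝ) * W.card :=
      mul_pos ((mul_pos hε ha).trans_le hlarge.1) ((mul_pos hε hb).trans_le hlarge.2)
    have hdens : density G U W * ((U.card : ℝ) * W.card) =
        ((U ×ˢ W).filter fun p => G.Adj p.1 p.2).card := by
      rw [density, div_mul_cancel₀ _ hpos.ne', ← Set.ncard_coe_finset]
      congr 2
      ext p
      simp [and_assoc]
    have herr : 0 ≤ ε * ((A.card : ℝ) * B.card) := by positivity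
    by_cases hP : P
    · simp only [hP, iff_true]
      rw [← hdens]
      nlinarith
    · simp only [hP, iff_false]
      have hsum := Finset.card_filter_add_card_filter_not (s := U ×ˢ W)
        (fun p : V × V => G.Adj p.1 p.2)
      rw [Finset.card_product] at hsum
      have hsum' : (((U ×ˢ W).filter fun p => G.Adj p.1 p.2).card : ℝ) +
          ((U ×ˢ W).filter fun p => ¬ G.Adj p.1 p.2).card = (U.card : ℝ) * W.card := by
        exact_mod_cast hsum
      rw [← hdens] at hsum'
      nlinarith
  · refine le_trans ?_ (Nat.cast_nonneg _)
    have hsmall : (U.card : ℝ) * W.card ≤ ε * ((A.card : ℝ) * B.card) := by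
      rcases not_and_or.1 hlarge with h | h <;> push Not at h <;> nlinarith
    nlinarith [mul_nonneg hu hw]

open scoped Classical in
/-- Imposing on the coordinates `a` and `b` a condition `R` that is satisfied by a fraction `β` of
all large enough rectangles reduces a family of tuples by at most a factor `β`, up to a small error,
provided that the family does not correlate the two coordinates. -/
lemma le_card_filter_of_rectangular {ι : Type*} [Fintype ι] {a b : ι} (hab : a ≠ b)
    (A : ι → Finset V) (S : Finset (ι → V)) (hS : S ⊆ Fintype.piFinset A)
    (hrect : ∀ x ∈ S, ∀ y ∈ S, (∀ i, i ≠ a → i ≠ b → x i = y i) →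
      Function.update x b (y b) ∈ S)
    (R : V → V → Prop) {β ε : ℝ}
    (hR : ∀ U ⊆ A a, ∀ W ⊆ A b,
      β * ((U.card : ℝ) * W.card) - ε * (((A a).card : ℝ) * (A b).card) ≤
        ((U ×ˢ W).filter fun p => R p.1 p.2).card) :
    β * (S.card : ℝ) - ε * ∏ i, ((A i).card : ℝ) ≤
      (S.filter fun x => R (x a) (x b)).card := by
  let π : (ι → V) → ({i // i ≠ a ∧ i ≠ b} → V) := fun x i => x i
  let Y : Finset ({i // i ≠ a ∧ i ≠ b} → V) := Fintype.piFinset fun i => A i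
  have hπ : ∀ x ∈ S, π x ∈ Y := fun x hx =>
    Fintype.mem_piFinset.2 fun i => Fintype.mem_piFinset.1 (hS hx) i
  have hfibre : ∀ y ∈ Y, β * ((S.filter fun x => π x = y).card : ℝ) -
      ε * (((A a).card : ℝ) * (A b).card) ≤
      ((S.filter fun x => R (x a) (x b)).filter fun x => π x = y).card := fun y _ => by
    set F := S.filter fun x => π x = y with hF
    set U := F.image fun x => x a with hU
    set W := F.image fun x => x b with hW
    have hagree : ∀ x ∈ F, ∀ z ∈ F, ∀ i, i ≠ a → i ≠ b → x i = z i := fun x hx z hz i hia hib => by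
      have := (Finset.mem_filter.1 hx).2.trans (Finset.mem_filter.1 hz).2.symm
      exact congrFun this ⟨i, hia, hib⟩
    have hinj : Set.InjOn (fun x : ι → V => (x a, x b)) F := fun x hx z hz hxz => by
      have hxz := Prod.mk.inj hxz
      funext i
      by_cases hia : i = a
      · exact hia ▸ hxz.1
      · by_cases hib : i = b
        · exact hib ▸ hxz.2
        · exact hagree x hx z hz i hia hib
    have himage : F.image (fun x => (x a, x b)) = U ×ˢ W := by
      ext ⟨u, w⟩
      simp only [hU, hW, Finset.mem_image, Finset.mem_product, Prod.mk.injEq]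
      constructor
      · rintro ⟨x, hx, rfl, rfl⟩
        exact ⟨⟨x, hx, rfl⟩, ⟨x, hx, rfl⟩⟩
      · rintro ⟨⟨x, hx, rfl⟩, ⟨z, hz, rfl⟩⟩
        refine ⟨Function.update x b (z b), Finset.mem_filter.2 ⟨?_, ?_⟩, ?_, ?_⟩
        · exact hrect x (Finset.mem_filter.1 hx).1 z (Finset.mem_filter.1 hz).1
            (hagree x hx z hz)
        · rw [← (Finset.mem_filter.1 hx).2]
          funext i
          exact Function.update_of_ne i.2.2 _ _
        · exact Function.update_of_ne hab _ _
        · simp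
    have hcard : (F.card : ℝ) = (U.card : ℝ) * W.card := by
      rw [← Finset.card_image_of_injOn hinj, himage, Finset.card_product, Nat.cast_mul]
    have hcard' : ((S.filter fun x => R (x a) (x b)).filter fun x => π x = y).card =
        ((U ×ˢ W).filter fun p => R p.1 p.2).card := by
      rw [Finset.filter_comm, ← hF, ← himage, Finset.filter_image,
        Finset.card_image_of_injOn (hinj.mono (Finset.coe_subset.2 (Finset.filter_subset _ _)))]
    rw [hcard, hcard']
    have hsub : ∀ i, F.image (fun x => x i) ⊆ A i := fun i u hu => by
      obtain ⟨x, hx, rfl⟩ := Finset.mem_image.1 hu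
      exact Fintype.mem_piFinset.1 (hS (Finset.mem_filter.1 hx).1) i
    exact hR U (hsub a) W (hsub b)
  have hprod : ∏ i, ((A i).card : ℝ) = Y.card * (((A a).card : ℝ) * (A b).card) := by
    rw [← Finset.prod_mul_prod_compl {a, b}, Finset.prod_pair hab, mul_comm, Fintype.card_piFinset,
      Nat.cast_prod]
    congr 1
    exact Finset.prod_subtype _ (by simp) _
  rw [Finset.card_eq_sum_card_fiberwise hπ, Finset.card_eq_sum_card_fiberwise
    (s := S.filter fun x => R (x a) (x b)) fun x hx => hπ x (Finset.mem_filter.1 hx).1]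
  have := Finset.sum_le_sum hfibre
  rw [Finset.sum_sub_distrib, ← Finset.mul_sum, Finset.sum_const, nsmul_eq_mul] at this
  push_cast
  rw [hprod]
  linarith

/-- If `x` and `y` agree outside `a` and `b`, then a relation between two coordinates, not both among
`a` and `b` unless equal, passes from `x` and `y` to the tuple with `a`-coordinate from `x` and
`b`-coordinate from `y`. -/
lemma update_rel {ι : Type*} [DecidableEq ι] {a b : ι} (hab : a ≠ b) {x y : ι → V}
    (hxy : ∀ i, i ≠ a → i ≠ b → x i = y i) {i j : ι} (h₁ : ¬ (i = a ∧ j = b))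
    (h₂ : ¬ (i = b ∧ j = a)) (T : V → V → Prop) (hx : T (x i) (x j)) (hy : T (y i) (y j)) :
    T (Function.update x b (y b) i) (Function.update x b (y b) j) := by
  have hzy : ∀ k, k ≠ a → Function.update x b (y b) k = y k := fun k hk => by
    by_cases hk' : k = b
    · subst hk'; simp
    · rw [Function.update_of_ne hk', hxy k hk hk']
  by_cases h : i = b ∨ j = b
  · rwa [hzy i (by grind), hzy j (by grind)]
  · push Not at h
    rwa [Function.update_of_ne h.1, Function.update_of_ne h.2]

open scoped Classical in
/-- Counting lemma: tuples satisfying prescribed conditions on pairs of coordinates in the same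
class remain numerous when conditions are imposed on pairs in different classes, provided that the
latter conditions are satisfied by a fraction `β` of all large enough rectangles. -/
lemma le_card_filter_forall_mem {ι κ : Type*} [Fintype ι] [LinearOrder κ] (p : ι → κ)
    (A : ι → Finset V) (D : ι → ι → V → V → Prop) (R : ι → ι → V → V → Prop) {β ε : ℝ}
    (hβ₀ : 0 ≤ β) (hβ₁ : β ≤ 1) (hε : 0 ≤ ε) (Q : Finset (ι × ι))
    (hQ : ∀ q ∈ Q, p q.1 < p q.2)
    (S₀ : Finset (ι → V))
    (hS₀ : ∀ x, x ∈ S₀ ↔ (∀ i, x i ∈ A i) ∧ ∀ i j, p i = p j → D i j (x i) (x j))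
    (hR : ∀ q ∈ Q, ∀ U ⊆ A q.1, ∀ W ⊆ A q.2,
      β * ((U.card : ℝ) * W.card) - ε * (((A q.1).card : ℝ) * (A q.2).card) ≤
        ((U ×ˢ W).filter fun w => R q.1 q.2 w.1 w.2).card) :
    β ^ Q.card * (S₀.card : ℝ) - Q.card * (ε * ∏ i, ((A i).card : ℝ)) ≤
      (S₀.filter fun x => ∀ q ∈ Q, R q.1 q.2 (x q.1) (x q.2)).card := by
  induction Q using Finset.induction_on with
  | empty => simp
  | insert q Q hq ih =>
    have ih := ih (fun q hq => hQ q (Finset.mem_insert_of_mem hq))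
      (fun q hq => hR q (Finset.mem_insert_of_mem hq))
    set S := S₀.filter fun x => ∀ q ∈ Q, R q.1 q.2 (x q.1) (x q.2) with hS
    have hlt := hQ q (Finset.mem_insert_self _ _)
    have hne : q.1 ≠ q.2 := fun h => hlt.ne (congrArg p h)
    have hstep := le_card_filter_of_rectangular hne A S
      (fun x hx => Fintype.mem_piFinset.2 ((hS₀ x).1 (Finset.mem_filter.1 hx).1).1) ?_ (R q.1 q.2)
      (hR q (Finset.mem_insert_self _ _))
    · have hfilter : (S₀.filter fun x => ∀ q' ∈ insert q Q, R q'.1 q'.2 (x q'.1) (x q'.2)) =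
          S.filter fun x => R q.1 q.2 (x q.1) (x q.2) := by
        ext x
        simp only [hS, Finset.mem_filter, Finset.forall_mem_insert]
        tauto
      rw [hfilter, Finset.card_insert_of_notMem hq]
      refine le_trans ?_ hstep
      have hmul := mul_le_mul_of_nonneg_left ih hβ₀
      have herr : 0 ≤ (Q.card : ℝ) * (ε * ∏ i, ((A i).card : ℝ)) :=
        mul_nonneg (Nat.cast_nonneg _)
          (mul_nonneg hε (Finset.prod_nonneg fun _ _ => Nat.cast_nonneg _))
      have := mul_le_of_le_one_left herr hβ₁
      push_cast
      rw [pow_succ]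
      linarith
    · intro x hx y hy hxy
      have hmem : ∀ w, w ∈ S ↔ ((∀ i, w i ∈ A i) ∧ ∀ i j, p i = p j → D i j (w i) (w j)) ∧
          ∀ q ∈ Q, R q.1 q.2 (w q.1) (w q.2) := fun w => by
        rw [hS, Finset.mem_filter, hS₀]
      rw [hmem] at hx hy ⊢
      refine ⟨⟨fun i => ?_, fun i j hij => ?_⟩, fun q' hq' => ?_⟩
      · exact update_rel hne hxy (i := i) (j := i) (fun h => hne (h.1.symm.trans h.2))
          (fun h => hne (h.2.symm.trans h.1)) (fun u _ => u ∈ A i) (hx.1.1 i) (hy.1.1 i)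
      · refine update_rel hne hxy ?_ ?_ (D i j) (hx.1.2 i j hij) (hy.1.2 i j hij)
        · rintro ⟨rfl, rfl⟩
          exact hlt.ne hij
        · rintro ⟨rfl, rfl⟩
          exact hlt.ne hij.symm
      · refine update_rel hne hxy ?_ ?_ (R q'.1 q'.2) (hx.2 q' hq') (hy.2 q' hq')
        · exact fun h => hq (Prod.ext h.1 h.2 ▸ hq')
        · intro h
          have hlt' := hQ q' (Finset.mem_insert_of_mem hq')
          rw [h.1, h.2] at hlt'
          exact hlt.asymm hlt'

open scoped Classical in
/-- Embedding form of the counting lemma. -/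
lemma exists_forall_mem_of_lt {ι κ : Type*} [Fintype ι] [LinearOrder κ] (p : ι → κ)
    (A : ι → Finset V) (D : ι → ι → V → V → Prop) (R : ι → ι → V → V → Prop) {β ε : ℝ}
    (hβ₀ : 0 ≤ β) (hβ₁ : β ≤ 1) (hε : 0 ≤ ε) (Q : Finset (ι × ι))
    (hQ : ∀ q ∈ Q, p q.1 < p q.2)
    (S₀ : Finset (ι → V))
    (hS₀ : ∀ x, x ∈ S₀ ↔ (∀ i, x i ∈ A i) ∧ ∀ i j, p i = p j → D i j (x i) (x j))
    (hR : ∀ q ∈ Q, ∀ U ⊆ A q.1, ∀ W ⊆ A q.2,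
      β * ((U.card : ℝ) * W.card) - ε * (((A q.1).card : ℝ) * (A q.2).card) ≤
        ((U ×ˢ W).filter fun w => R q.1 q.2 w.1 w.2).card)
    (hlt : Q.card * (ε * ∏ i, ((A i).card : ℝ)) < β ^ Q.card * (S₀.card : ℝ)) :
    ∃ x ∈ S₀, ∀ q ∈ Q, R q.1 q.2 (x q.1) (x q.2) := by
  have h := (sub_pos.2 hlt).trans_le
    (le_card_filter_forall_mem p A D R hβ₀ hβ₁ hε Q hQ S₀ hS₀ hR)
  obtain ⟨x, hx⟩ := Finset.card_pos.1 (Nat.cast_pos.1 h)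
  exact ⟨x, Finset.mem_filter.1 hx⟩

/-- Tuples indexed by a product that form a clique in each part are at least as numerous as the
corresponding families of tuples. -/
lemma prod_card_cliqueTuples_le {r m : ℕ} (g : Fin r → SimpleGraph V) (A : Fin r → Finset V)
    (S : Finset (Fin r × Fin m → V))
    (hS : ∀ x, x ∈ S ↔ (∀ i, x i ∈ A i.1) ∧
      ∀ i j, i.1 = j.1 → i ≠ j → (g i.1).Adj (x i) (x j)) :
    ∏ j, (cliqueTuples (g j) (A j) m).card ≤ S.card := by
  classical
  rw [← Fintype.card_piFinset]
  refine Finset.card_le_card_of_injOn (fun y i => y i.1 i.2) (fun y hy => ?_) ?_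
  · simp only [Finset.mem_coe, Fintype.mem_piFinset, mem_cliqueTuples, hS] at hy ⊢
    refine ⟨fun i => (hy i.1).1 i.2, ?_⟩
    rintro ⟨i, k⟩ ⟨j, l⟩ (rfl : i = j) h
    exact (hy i).2 k l fun hkl => h (by rw [hkl])
  · intro y _ y' _ h
    funext i k
    exact congrFun h (i, k)

/-- **Lemma (induced embedding lemma).**  Given `δ > 0` and `m, r ∈ ℕ`, there exist `ε > 0`
and `n₀` such that: if `G` is a graph on vertex set `A 1 ∪ … ∪ A r` with `|A j| ≥ n₀` for
each `j`, and every pair `(A i, A j)` with `i ≠ j` is `(ε,δ)`-grey, then there is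
`v ∈ {0,1}^r` such that every graph `H ∈ ℋ(r,v)` with at most `m` vertices is an induced
subgraph of `G`. -/
theorem induced_embedding (δ : ℝ) (hδ : 0 < δ) (m r : ℕ) :
    ∃ ε : ℝ, 0 < ε ∧ ∃ n₀ : ℕ,
      ∀ (V : Type) [Fintype V] [DecidableEq V] (G : SimpleGraph V)
        (A : Fin r → Finset V),
        (∀ i j : Fin r, i ≠ j → Disjoint (A i) (A j)) →
        Finset.univ.biUnion A = Finset.univ →
        (∀ j : Fin r, n₀ ≤ (A j).card) →
        (∀ i j : Fin r, i ≠ j → IsGrey G ε δ (A i) (A j)) →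
        ∃ v : Fin r → Bool, ∀ (s : ℕ) (H : SimpleGraph (Fin s)), s ≤ m →
          InHClass r v H →
          ∃ f : Fin s ↪ V, ∀ x y : Fin s, G.Adj (f x) (f y) ↔ H.Adj x y := by
  classical
  obtain ⟨c, hc, n, hramsey⟩ := exists_le_card_cliqueTuples m m
  set β : ℝ := min δ 1 / 2 with hβ
  have hβ₀ : 0 < β := by positivity
  have hβ₁ : β ≤ 1 := by have := min_le_right δ 1; linarith
  have hβδ : β ≤ δ / 2 := by have := min_le_left δ 1; linarith
  set Q : Finset ((Fin r × Fin m) × (Fin r × Fin m)) :=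
    Finset.univ.filter fun q => q.1.1 < q.2.1 with hQ
  set η : ℝ := β ^ Q.card * c ^ r / (Q.card + 1) with hη
  have hη₀ : 0 < η := by positivity
  refine ⟨min β η, lt_min hβ₀ hη₀, n + 1, fun V _ _ G A hdisj _ hcard hgrey => ?_⟩
  have hε₀ : 0 < min β η := lt_min hβ₀ hη₀
  have hne : ∀ j, (A j).Nonempty := fun j => Finset.card_pos.1 (by have := hcard j; omega)
  have hcolour : ∀ j, ∃ v : Bool,
      c * ((A j).card : ℝ) ^ m ≤ (cliqueTuples (if v then G else Gᶜ) (A j) m).card := fun j => by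
    rcases hramsey V G Gᶜ (A j) (fun x y hxy => by simp [hxy, em]) (by have := hcard j; omega)
      with h | h
    exacts [⟨true, h⟩, ⟨false, h⟩]
  choose v hv using hcolour
  refine ⟨v, fun s H hs ⟨f, hf⟩ => ?_⟩
  let g : Fin r → SimpleGraph V := fun j => if v j then G else Gᶜ
  obtain ⟨S, hS⟩ : ∃ S : Finset (Fin r × Fin m → V), ∀ x, x ∈ S ↔ (∀ i, x i ∈ A i.1) ∧
      ∀ i j, i.1 = j.1 → i ≠ j → (g i.1).Adj (x i) (x j) :=
    ⟨Finset.univ.filter fun x => (∀ i, x i ∈ A i.1) ∧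
      ∀ i j, i.1 = j.1 → i ≠ j → (g i.1).Adj (x i) (x j), by simp⟩
  set P : ℝ := ∏ i : Fin r × Fin m, ((A i.1).card : ℝ) with hP
  have hP₀ : 0 < P := Finset.prod_pos fun i _ => by exact_mod_cast (hne i.1).card_pos
  have hhom : c ^ r * P ≤ (S.card : ℝ) := by
    calc c ^ r * P = ∏ j, c * ((A j).card : ℝ) ^ m := by
          rw [Finset.prod_mul_distrib, hP, Fintype.prod_prod_type]
          simp
      _ ≤ ∏ j, ((cliqueTuples (g j) (A j) m).card : ℝ) :=
          Finset.prod_le_prod (fun j _ => by positivity) fun j _ => hv j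
      _ ≤ _ := by exact_mod_cast prod_card_cliqueTuples_le g A S hS
  have hpos : Q.card * (min β η * P) < β ^ Q.card * (c ^ r * P) := by
    have h₁ : β ^ Q.card * c ^ r = (Q.card + 1) * η := by rw [hη]; field_simp
    have h₂ : (Q.card : ℝ) * (min β η * P) ≤ Q.card * (η * P) := by
      exact mul_le_mul_of_nonneg_left (mul_le_mul_of_nonneg_right (min_le_right _ _) hP₀.le)
        (Nat.cast_nonneg _)
    nlinarith [mul_pos hη₀ hP₀]
  obtain ⟨x, hxS, hxQ⟩ := exists_forall_mem_of_lt (fun i : Fin r × Fin m => i.1) (fun i => A i.1)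
    (fun i j x y => i ≠ j → (g i.1).Adj x y)
    (fun i j x y => G.Adj x y ↔
      ∃ (hi : (i.2 : ℕ) < s) (hj : (j.2 : ℕ) < s), H.Adj ⟨i.2, hi⟩ ⟨j.2, hj⟩)
    hβ₀.le hβ₁ hε₀.le Q (fun q hq => (Finset.mem_filter.1 hq).2) S hS (fun q hq U hU W hW => by
      convert (hgrey q.1.1 q.2.1 (Finset.mem_filter.1 hq).2.ne).le_card_filter hε₀ hβ₀.le hβ₁
        (by have := min_le_left β η; linarith) (hne _) (hne _) hU hW _)
    (hpos.trans_le (mul_le_mul_of_nonneg_left hhom (pow_nonneg hβ₀.le _)))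
  obtain ⟨hxA, hxD⟩ := (hS x).1 hxS
  let e : Fin s → Fin r × Fin m := fun a => (f a, Fin.castLE hs a)
  have hcross : ∀ a b, f a < f b → (G.Adj (x (e a)) (x (e b)) ↔ H.Adj a b) := fun a b hab => by
    simpa [e] using hxQ (e a, e b) (Finset.mem_filter.2 ⟨Finset.mem_univ _, hab⟩)
  have hne' : ∀ a b, a ≠ b → e a ≠ e b := fun a b hab h =>
    hab (Fin.castLE_injective hs (Prod.ext_iff.1 h).2)
  refine ⟨⟨fun a => x (e a), fun a b hab => ?_⟩, fun a b => ?_⟩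
  · by_contra h
    by_cases hfab : f a = f b
    · exact (hxD (e a) (e b) hfab (hne' a b h)).ne hab
    · exact Finset.disjoint_left.1 (hdisj _ _ hfab) (hxA (e a))
        ((congrArg (· ∈ A (f b)) hab).mpr (hxA (e b)))
  · change G.Adj (x (e a)) (x (e b)) ↔ H.Adj a b
    rcases lt_trichotomy (f a) (f b) with h | h | h
    · exact hcross a b h
    · by_cases hab : a = b
      · subst hab; simp
      · have hD : (if v (f a) = true then G else Gᶜ).Adj (x (e a)) (x (e b)) :=
          hxD (e a) (e b) h (hne' a b hab)
        rw [hf a b hab h]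
        cases hva : v (f a)
        · rw [hva] at hD
          simpa using ((SimpleGraph.compl_adj ..).1 hD).2
        · rw [hva] at hD
          simpa using hD
    · rw [G.adj_comm, H.adj_comm, hcross b a h]

end ABBM
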